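/- Let J∘ be an S∞-invariant ideal chain in R such that there exists N ∈ ℕ with in_⪯(J_n) = Σ_{1 ≤ i₁ < ... < i_N ≤ n} ⟨in_⪯(J_n ∩ R_{{i₁,...,i_N}})⟩_{R_n} for all n ≥ N and every Inc(ℕ)-compatible term order ⪯ on R. Then I(J∘) is bounded above. -/

import Mathlib

open MvPolynomial

/-- The ambient polynomial ring `R = K[x_{i,j} | i ∈ [c], j ∈ ℕ]`
(second variable indices are written `0`-based). -/
abbrev PolyR (K : Type*) [Field K] (c : ℕ) : Type _ := MvPolynomial (Fin c × ℕ) K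

/-- The action of `p : ℕ → ℕ` on variable indices: `x_{i,j} ↦ x_{i,p(j)}`. -/
def incVar (c : ℕ) (p : ℕ → ℕ) : Fin c × ℕ → Fin c × ℕ := fun v => (v.1, p v.2)

/-- The `K`-linear (in fact `K`-algebra) action of `p : ℕ → ℕ` on `R`. -/
noncomputable def incAct (K : Type*) [Field K] (c : ℕ) (p : ℕ → ℕ) :
    PolyR K c →ₐ[K] PolyR K c := rename (incVar c p)

/-- `Inc(ℕ)_{m,n}`: strictly increasing maps sending the first `m` variable indices
into the first `n` variable indices. -/
def IncIn (m n : ℕ) : Set (ℕ → ℕ) := {p | StrictMono p ∧ ∀ j < m, p j < n}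

/-- `R_A`: the polynomials using only variables `x_{i,j}` with `j ∈ A`. -/
def RsetOn (K : Type*) [Field K] (c : ℕ) (A : Set ℕ) : Set (PolyR K c) :=
  (supported K {v : Fin c × ℕ | v.2 ∈ A} : Subalgebra K (PolyR K c))

/-- `R_n`: the polynomials using only the first `n` variable indices. -/
def Rset (K : Type*) [Field K] (c n : ℕ) : Set (PolyR K c) := RsetOn K c {j | j < n}

/-- `J` is an ideal of the subring of `R` with underlying set `A`. -/
def IsIdealOf {K : Type*} [Field K] {c : ℕ} (J A : Set (PolyR K c)) : Prop :=
  J ⊆ A ∧ (0 : PolyR K c) ∈ J ∧ (∀ f ∈ J, ∀ g ∈ J, f + g ∈ J) ∧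
    ∀ a ∈ A, ∀ f ∈ J, a * f ∈ J

/-- The ideal of the subring of `R` with underlying set `A` generated by `S`. -/
def spanIn {K : Type*} [Field K] {c : ℕ} (A S : Set (PolyR K c)) : Set (PolyR K c) :=
  ⋂₀ {J : Set (PolyR K c) | IsIdealOf J A ∧ S ⊆ J}

/-- The set `Inc(ℕ)_{m,n} · S`. -/
def incOrbit (K : Type*) [Field K] (c m n : ℕ) (S : Set (PolyR K c)) : Set (PolyR K c) :=
  {g | ∃ p ∈ IncIn m n, ∃ f ∈ S, g = incAct K c p f}

/-- An `Inc(ℕ)`-invariant ideal chain in `R`. -/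
def IsIncChain (K : Type*) [Field K] (c : ℕ) (J : ℕ → Set (PolyR K c)) : Prop :=
  (∀ n, IsIdealOf (J n) (Rset K c n)) ∧
    ∀ m n, m ≤ n → incOrbit K c m n (J m) ⊆ J n

/-- The set of indices from which on the chain `J` is generated by `Inc(ℕ)`-shifts. -/
def stabSet (K : Type*) [Field K] (c : ℕ) (J : ℕ → Set (PolyR K c)) : Set ℕ :=
  {N | ∀ n, N ≤ n → spanIn (Rset K c n) (incOrbit K c N n (J N)) = J n}

/-- The stability index `Ind(J∘)` of an ideal chain. -/
noncomputable def Ind (K : Type*) [Field K] (c : ℕ) (J : ℕ → Set (PolyR K c)) : ℕ :=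
  sInf (stabSet K c J)

/-- A term order: a total order on monomials (identified with their exponent vectors,
so that multiplication of monomials becomes addition) which respects multiplication and
has the monomial `1` (exponent vector `0`) as least element. -/
structure TermOrder (σ : Type*) where
  le : (σ →₀ ℕ) → (σ →₀ ℕ) → Prop
  refl : ∀ a, le a a
  trans : ∀ a b c, le a b → le b c → le a c
  antisymm : ∀ a b, le a b → le b a → a = b
  total : ∀ a b, le a b ∨ le b a
  add_right : ∀ a b h, le a b → le (a + h) (b + h)
  zero_le : ∀ a, le 0 a

/-- A term order on `R` is `Inc(ℕ)`-compatible if it is preserved by the action of every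
strictly increasing map. -/
def IncCompatible (c : ℕ) (T : TermOrder (Fin c × ℕ)) : Prop :=
  ∀ p : ℕ → ℕ, StrictMono p → ∀ a b, T.le a b →
    T.le (Finsupp.mapDomain (incVar c p) a) (Finsupp.mapDomain (incVar c p) b)

/-- `a` is the exponent vector of the leading monomial of `f` with respect to `T`. -/
def IsLeadMon {K : Type*} [Field K] {c : ℕ} (T : TermOrder (Fin c × ℕ))
    (f : PolyR K c) (a : (Fin c × ℕ) →₀ ℕ) : Prop :=
  a ∈ f.support ∧ ∀ b ∈ f.support, T.le b a

/-- The set of leading monomials of the nonzero elements of `J`. -/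
def leadMonSet (K : Type*) [Field K] (c : ℕ) (T : TermOrder (Fin c × ℕ))
    (J : Set (PolyR K c)) : Set (PolyR K c) :=
  {g | ∃ f ∈ J, f ≠ 0 ∧ ∃ a, IsLeadMon T f a ∧ g = monomial a (1 : K)}

/-- The initial ideal of `J`, as an ideal of `R_A`. -/
def initialOn (K : Type*) [Field K] (c : ℕ) (T : TermOrder (Fin c × ℕ)) (A : Set ℕ)
    (J : Set (PolyR K c)) : Set (PolyR K c) :=
  spanIn (RsetOn K c A) (leadMonSet K c T J)

/-- The chain of initial ideals `in_T(J_1) ⊆ in_T(J_2) ⊆ ...`. -/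
def inChain (K : Type*) [Field K] (c : ℕ) (T : TermOrder (Fin c × ℕ))
    (J : ℕ → Set (PolyR K c)) : ℕ → Set (PolyR K c) :=
  fun n => initialOn K c T {j | j < n} (J n)

/-- `I(J∘)`: the set of stability indices of initial ideal chains of `J` with respect to
`Inc(ℕ)`-compatible term orders. -/
def IndSet (K : Type*) [Field K] (c : ℕ) (J : ℕ → Set (PolyR K c)) : Set ℕ :=
  {N | ∃ T : TermOrder (Fin c × ℕ), IncCompatible c T ∧ Ind K c (inChain K c T J) = N}

/-- `S_n`: bijections of the variable indices fixing all indices outside the first `n`. -/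
def SymN (n : ℕ) : Set (ℕ → ℕ) := {σ | Function.Bijective σ ∧ ∀ i, n ≤ i → σ i = i}

/-- An `S_∞`-invariant ideal chain in `R`. -/
def IsSymChain (K : Type*) [Field K] (c : ℕ) (J : ℕ → Set (PolyR K c)) : Prop :=
  (∀ n, IsIdealOf (J n) (Rset K c n)) ∧
    ∀ m n, m ≤ n → ∀ σ ∈ SymN n, ∀ f ∈ J m, incAct K c σ f ∈ J n

lemma incAct_mem_RsetOn {K : Type*} [Field K] {c : ℕ} {A B : Set ℕ} {p : ℕ → ℕ}
    (hp : ∀ j ∈ A, p j ∈ B) {f : PolyR K c} (hf : f ∈ RsetOn K c A) :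
    incAct K c p f ∈ RsetOn K c B := by
  classical
  have hf' : (f.vars : Set (Fin c × ℕ)) ⊆ {v | v.2 ∈ A} := mem_supported.1 hf
  refine mem_supported.2 fun v hv => ?_
  obtain ⟨w, hw, rfl⟩ := Finset.mem_image.1 (vars_rename (incVar c p) f hv)
  exact hp _ (hf' hw)

lemma incAct_incAct {K : Type*} [Field K] {c : ℕ} (p q : ℕ → ℕ) (f : PolyR K c) :
    incAct K c p (incAct K c q f) = incAct K c (p ∘ q) f := by
  rw [incAct, incAct, incAct, rename_rename]
  rfl

lemma incAct_congr {K : Type*} [Field K] {c : ℕ} {A : Set ℕ} {p q : ℕ → ℕ}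
    (h : ∀ j ∈ A, p j = q j) {f : PolyR K c} (hf : f ∈ RsetOn K c A) :
    incAct K c p f = incAct K c q f := by
  have hf' : (f.vars : Set (Fin c × ℕ)) ⊆ {v | v.2 ∈ A} := mem_supported.1 hf
  obtain ⟨g, rfl⟩ := exists_rename_eq_of_vars_subset_range f
    (Subtype.val : {v : Fin c × ℕ | v.2 ∈ A} → Fin c × ℕ) Subtype.val_injective
    (by simpa using hf')
  rw [incAct, incAct, rename_rename, rename_rename]
  congr 2
  funext v
  simp only [Function.comp_apply, incVar]
  rw [h _ v.2]

lemma incAct_eq_self {K : Type*} [Field K] {c : ℕ} {A : Set ℕ} {p : ℕ → ℕ}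
    (h : ∀ j ∈ A, p j = j) {f : PolyR K c} (hf : f ∈ RsetOn K c A) :
    incAct K c p f = f := by
  rw [incAct_congr (q := id) h hf, incAct]
  exact rename_id_apply f

lemma RsetOn_mono {K : Type*} [Field K] {c : ℕ} {A B : Set ℕ} (h : A ⊆ B) :
    RsetOn K c A ⊆ RsetOn K c B :=
  fun _ hf => mem_supported.2 ((mem_supported.1 hf).trans fun _ hv => h hv)

lemma incVar_injective (c : ℕ) {p : ℕ → ℕ} (hp : Function.Injective p) :
    Function.Injective (incVar c p) := by
  rintro ⟨a, b⟩ ⟨a', b'⟩ h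
  simp only [incVar, Prod.mk.injEq] at h
  exact Prod.ext h.1 (hp h.2)

lemma isIdealOf_spanIn {K : Type*} [Field K] {c : ℕ} {A : Set ℕ} {S : Set (PolyR K c)}
    (hS : S ⊆ RsetOn K c A) : IsIdealOf (spanIn (RsetOn K c A) S) (RsetOn K c A) := by
  refine ⟨Set.sInter_subset_of_mem ⟨⟨subset_rfl, ?_, ?_, ?_⟩, hS⟩, ?_, ?_, ?_⟩
  · exact Subalgebra.zero_mem _
  · exact fun f hf g hg => Subalgebra.add_mem _ hf hg
  · exact fun a ha f hf => Subalgebra.mul_mem _ ha hf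
  · exact fun I hI => hI.1.2.1
  · exact fun f hf g hg I hI => hI.1.2.2.1 f (hf I hI) g (hg I hI)
  · exact fun a ha f hf I hI => hI.1.2.2.2 a ha f (hf I hI)

lemma subset_spanIn {K : Type*} [Field K] {c : ℕ} (A S : Set (PolyR K c)) : S ⊆ spanIn A S :=
  fun _ hf _ hI => hI.2 hf

lemma spanIn_subset {K : Type*} [Field K] {c : ℕ} {A S I : Set (PolyR K c)}
    (hI : IsIdealOf I A) (hS : S ⊆ I) : spanIn A S ⊆ I :=
  Set.sInter_subset_of_mem ⟨hI, hS⟩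

/-- The contraction of an ideal to a smaller polynomial ring, along an index map. -/
lemma IsIdealOf.comap {K : Type*} [Field K] {c : ℕ} {A B : Set ℕ} {I : Set (PolyR K c)}
    (hI : IsIdealOf I (RsetOn K c B)) {p : ℕ → ℕ} (hp : ∀ j ∈ A, p j ∈ B) :
    IsIdealOf {f | f ∈ RsetOn K c A ∧ incAct K c p f ∈ I} (RsetOn K c A) := by
  refine ⟨fun f hf => hf.1, ⟨Subalgebra.zero_mem _, ?_⟩, fun f hf g hg => ⟨?_, ?_⟩,
    fun a ha f hf => ⟨?_, ?_⟩⟩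
  · rw [map_zero]
    exact hI.2.1
  · exact Subalgebra.add_mem _ hf.1 hg.1
  · rw [map_add]
    exact hI.2.2.1 _ hf.2 _ hg.2
  · exact Subalgebra.mul_mem _ ha hf.1
  · rw [map_mul]
    exact hI.2.2.2 _ (incAct_mem_RsetOn hp ha) _ hf.2

lemma leadMonSet_subset {K : Type*} [Field K] {c : ℕ} {T : TermOrder (Fin c × ℕ)} {A : Set ℕ}
    {J : Set (PolyR K c)} (hJ : J ⊆ RsetOn K c A) : leadMonSet K c T J ⊆ RsetOn K c A := by
  rintro _ ⟨f, hf, -, a, ha, rfl⟩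
  have hf' : (f.vars : Set (Fin c × ℕ)) ⊆ {v | v.2 ∈ A} := mem_supported.1 (hJ hf)
  refine mem_supported.2 fun v hv => hf' ?_
  rw [vars_monomial one_ne_zero] at hv
  exact (mem_vars_iff_mem_support v).2 ⟨a, ha.1, hv⟩

/-- Taking leading monomials commutes with strictly increasing index maps. -/
lemma IsLeadMon.incAct {K : Type*} [Field K] {c : ℕ} {T : TermOrder (Fin c × ℕ)}
    (hT : IncCompatible c T) {p : ℕ → ℕ} (hp : StrictMono p) {f : PolyR K c}
    {a : (Fin c × ℕ) →₀ ℕ} (ha : IsLeadMon T f a) :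
    IsLeadMon T (incAct K c p f) (Finsupp.mapDomain (incVar c p) a) := by
  classical
  have hs := support_rename_of_injective (p := f) (incVar_injective c hp.injective)
  constructor
  · rw [_root_.incAct, hs]
    exact Finset.mem_image_of_mem _ ha.1
  · intro b hb
    rw [_root_.incAct, hs] at hb
    obtain ⟨b', hb', rfl⟩ := Finset.mem_image.1 hb
    exact hT p hp _ _ (ha.2 b' hb')

lemma TermOrder.exists_isLeadMon {K : Type*} [Field K] {c : ℕ} (T : TermOrder (Fin c × ℕ))
    {f : PolyR K c} (hf : f ≠ 0) : ∃ a, IsLeadMon T f a := by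
  suffices h : ∀ s : Finset ((Fin c × ℕ) →₀ ℕ), s.Nonempty → ∃ a ∈ s, ∀ b ∈ s, T.le b a from
    h _ (support_nonempty.2 hf)
  intro s hs
  induction hs using Finset.Nonempty.cons_induction with
  | singleton a => exact ⟨a, by simp, by simpa using T.refl a⟩
  | cons a s ha hs ih =>
    obtain ⟨m, hm, hmax⟩ := ih
    simp only [Finset.mem_cons, exists_eq_or_imp, forall_eq_or_imp]
    rcases T.total a m with h | h
    · exact Or.inr ⟨m, hm, h, hmax⟩
    · exact Or.inl ⟨T.refl a, fun b hb => T.trans _ _ _ (hmax b hb) h⟩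

lemma TermOrder.isLeadMon_unique {K : Type*} [Field K] {c : ℕ} {T : TermOrder (Fin c × ℕ)}
    {f : PolyR K c} {a b : (Fin c × ℕ) →₀ ℕ} (ha : IsLeadMon T f a) (hb : IsLeadMon T f b) :
    a = b :=
  T.antisymm _ _ (hb.2 a ha.1) (ha.2 b hb.1)

/-- An injection of the first `m` indices into the first `n` extends to a permutation in `S_n`. -/
lemma exists_perm_extend {m n : ℕ} (hmn : m ≤ n) {p : ℕ → ℕ} (hp : ∀ j < m, p j < n)
    (hinj : Set.InjOn p (Set.Iio m)) :
    ∃ σ : Equiv.Perm ℕ, (∀ i, n ≤ i → σ i = i) ∧ ∀ j < m, σ j = p j := by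
  classical
  obtain ⟨g, hg⟩ := Finset.exists_equiv_extend_of_card_eq (α := Finset.range n)
    (t := Finset.range n) (by simp)
    (s := Finset.univ.filter fun x => x.1 < m) (f := fun x => p x.1)
    (by
      intro y hy
      obtain ⟨x, hx, rfl⟩ := Finset.mem_image.1 hy
      exact Finset.mem_range.2 (hp _ (by simpa using hx)))
    (by
      intro x hx y hy h
      exact Subtype.ext (hinj (by simpa using hx) (by simpa using hy) h))
  refine ⟨Equiv.Perm.ofSubtype (p := (· ∈ Finset.range n)) g, fun i hi => ?_, fun j hj => ?_⟩
  · exact Equiv.Perm.ofSubtype_apply_of_not_mem _ (by simpa using hi)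
  · have hjn : j ∈ Finset.range n := Finset.mem_range.2 (hj.trans_le hmn)
    rw [Equiv.Perm.ofSubtype_apply_of_mem _ hjn]
    exact hg ⟨j, hjn⟩ (by simpa using hj)

/-- Any `N` indices below `n` lie in the image of the first `M` under a map in `Inc(ℕ)_{M,n}`. -/
lemma exists_incIn_cover {N M n : ℕ} (hNM : N ≤ M) (hMn : M ≤ n) (i : Fin N → ℕ)
    (hi : ∀ r, i r < n) : ∃ p ∈ IncIn M n, ∀ r, ∃ j < M, p j = i r := by
  classical
  obtain ⟨B, hB, hBn, hcard⟩ := Finset.exists_subsuperset_card_eq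
    (s := Finset.univ.image i) (t := Finset.range n) (n := M)
    (by
      intro x hx
      obtain ⟨r, -, rfl⟩ := Finset.mem_image.1 hx
      exact Finset.mem_range.2 (hi r))
    (Finset.card_image_le.trans (by simpa using hNM)) (by simpa using hMn)
  have hlt : ∀ j, B.orderEmbOfFin hcard j < n := fun j =>
    Finset.mem_range.1 (hBn (B.orderEmbOfFin_mem hcard j))
  refine ⟨fun j => if h : j < M then B.orderEmbOfFin hcard ⟨j, h⟩ else n + j, ⟨?_, ?_⟩, ?_⟩
  · intro a b hab
    dsimp only
    split_ifs with ha hb hb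
    · exact (B.orderEmbOfFin hcard).strictMono hab
    · exact (hlt _).trans_le (Nat.le_add_right _ _)
    · omega
    · omega
  · intro j hj
    simp only [hj, dite_true]
    exact hlt _
  · intro r
    have hr : i r ∈ Set.range (B.orderEmbOfFin hcard) := by
      rw [Finset.range_orderEmbOfFin]
      exact hB (Finset.mem_image_of_mem _ (Finset.mem_univ r))
    obtain ⟨j, hj⟩ := hr
    exact ⟨j, j.2, by simpa using hj⟩

lemma IsSymChain.mono {K : Type*} [Field K] {c : ℕ} {J : ℕ → Set (PolyR K c)}
    (hJ : IsSymChain K c J) : Monotone J := by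
  intro m n hmn f hf
  have h := hJ.2 m n hmn id ⟨Function.bijective_id, fun _ _ => rfl⟩ f hf
  rwa [incAct_eq_self (A := Set.univ) (p := id) (fun _ _ => rfl)
    (RsetOn_mono (Set.subset_univ _) ((hJ.1 m).1 hf))] at h

lemma IsSymChain.perm_mem {K : Type*} [Field K] {c : ℕ} {J : ℕ → Set (PolyR K c)}
    (hJ : IsSymChain K c J) {n : ℕ} {σ : Equiv.Perm ℕ} (hσ : ∀ i, n ≤ i → σ i = i)
    {f : PolyR K c} (hf : f ∈ J n) : incAct K c σ f ∈ J n :=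
  hJ.2 n n le_rfl σ ⟨σ.bijective, hσ⟩ f hf

lemma IsSymChain.isIncChain {K : Type*} [Field K] {c : ℕ} {J : ℕ → Set (PolyR K c)}
    (hJ : IsSymChain K c J) : IsIncChain K c J := by
  refine ⟨hJ.1, ?_⟩
  rintro m n hmn _ ⟨p, hp, f, hf, rfl⟩
  obtain ⟨σ, hσ, hσp⟩ := exists_perm_extend hmn hp.2 hp.1.injective.injOn
  rw [incAct_congr (fun j hj => (hσp j hj).symm) ((hJ.1 m).1 hf)]
  exact hJ.perm_mem hσ (hJ.mono hmn hf)

/-- The ascending chain of contractions `J_n ∩ R_N` stabilizes. -/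
lemma IsSymChain.exists_contraction_stable {K : Type*} [Field K] {c : ℕ}
    {J : ℕ → Set (PolyR K c)} (hJ : IsSymChain K c J) (N : ℕ) :
    ∃ M, N ≤ M ∧ ∀ n, ∀ f ∈ J n, f ∈ Rset K c N → f ∈ J M := by
  let ι : Fin c × Fin N → Fin c × ℕ := fun v => (v.1, v.2)
  have hι : Function.Injective ι := by
    rintro ⟨a, b⟩ ⟨a', b'⟩ h
    simp only [ι, Prod.mk.injEq] at h
    exact Prod.ext h.1 (Fin.ext h.2)
  have hrange : ∀ g : MvPolynomial (Fin c × Fin N) K, rename ι g ∈ Rset K c N := by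
    classical
    refine fun g => mem_supported.2 fun v hv => ?_
    obtain ⟨w, -, rfl⟩ := Finset.mem_image.1 (vars_rename ι g hv)
    exact w.2.2
  let I : ℕ →o Ideal (MvPolynomial (Fin c × Fin N) K) :=
    { toFun := fun k =>
        { carrier := {g | rename ι g ∈ J (N + k)}
          zero_mem' := by
            rw [Set.mem_ofPred_eq, map_zero]
            exact (hJ.1 _).2.1
          add_mem' := fun {a b} ha hb => by
            rw [Set.mem_ofPred_eq, map_add]
            exact (hJ.1 _).2.2.1 _ ha _ hb
          smul_mem' := fun a b hb => by
            rw [Set.mem_ofPred_eq, smul_eq_mul, map_mul]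
            refine (hJ.1 _).2.2.2 _ (RsetOn_mono ?_ (hrange a)) _ hb
            exact fun j hj => Nat.lt_add_right k hj }
      monotone' := fun k l hkl _ hg => hJ.mono (Nat.add_le_add_left hkl N) hg }
  obtain ⟨k, hk⟩ := monotone_stabilizes_iff_noetherian.2
    (inferInstance : IsNoetherianRing (MvPolynomial (Fin c × Fin N) K)) I
  refine ⟨N + k, Nat.le_add_right _ _, fun n f hf hfN => ?_⟩
  have hf' : (f.vars : Set (Fin c × ℕ)) ⊆ {v | v.2 < N} := mem_supported.1 hfN
  obtain ⟨g, rfl⟩ := exists_rename_eq_of_vars_subset_range f ι hι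
    (fun v hv => ⟨(v.1, ⟨v.2, hf' hv⟩), rfl⟩)
  have hg : g ∈ I (max k n) := hJ.mono (by omega) hf
  rw [← hk _ (le_max_left _ _)] at hg
  exact hg

/-- Once `J_n ∩ R_N` has stabilized, every element of the chain supported on `N` of the first
`M` columns already lies in `J_M`. -/
lemma IsSymChain.mem_of_contraction_stable {K : Type*} [Field K] {c : ℕ}
    {J : ℕ → Set (PolyR K c)} (hJ : IsSymChain K c J) {N M n : ℕ} (hNM : N ≤ M) (hMn : M ≤ n)
    (hM : ∀ f ∈ J n, f ∈ Rset K c N → f ∈ J M) {h : Fin N → ℕ} (hinj : Function.Injective h)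
    (hlt : ∀ r, h r < M) {g : PolyR K c} (hg : g ∈ J n) (hgh : g ∈ RsetOn K c (Set.range h)) :
    g ∈ J M := by
  obtain ⟨σ, hσ, hσh⟩ := exists_perm_extend (p := fun j => if hj : j < N then h ⟨j, hj⟩ else j)
    hNM (fun j hj => by simpa only [hj, dite_true] using hlt _)
    (fun a ha b hb hab => by
      have ha' : a < N := ha
      have hb' : b < N := hb
      simp only [ha', hb', dite_true] at hab
      exact congrArg Fin.val (hinj hab))
  have hσ' : ∀ i, M ≤ i → σ.symm i = i := fun i hi => by
    rw [Equiv.symm_apply_eq, hσ i hi]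
  have hN : incAct K c σ.symm g ∈ Rset K c N := by
    refine incAct_mem_RsetOn ?_ hgh
    rintro _ ⟨r, rfl⟩
    have : σ r = h r := by rw [hσh r r.2, dif_pos r.2]
    rw [← this, Equiv.symm_apply_apply]
    exact r.2
  have hmem := hM _ (hJ.perm_mem (fun i hi => hσ' i (hMn.trans hi)) hg) hN
  have := hJ.perm_mem hσ hmem
  rwa [incAct_incAct, incAct_eq_self (p := σ ∘ σ.symm) (fun j _ => σ.apply_symm_apply j) hgh] at this

/-- Initial ideals of an `Inc(ℕ)`-invariant chain form an `Inc(ℕ)`-invariant chain. -/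
lemma IsIncChain.inChain {K : Type*} [Field K] {c : ℕ} {J : ℕ → Set (PolyR K c)}
    (hJ : IsIncChain K c J) {T : TermOrder (Fin c × ℕ)} (hT : IncCompatible c T) :
    IsIncChain K c (inChain K c T J) := by
  have hideal : ∀ n, IsIdealOf (_root_.inChain K c T J n) (Rset K c n) := fun n =>
    isIdealOf_spanIn (leadMonSet_subset (hJ.1 n).1)
  refine ⟨hideal, ?_⟩
  rintro m n hmn _ ⟨p, hp, f, hf, rfl⟩
  refine (spanIn_subset ((hideal n).comap (A := {j | j < m}) hp.2) ?_ hf).2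
  intro g hg
  refine ⟨leadMonSet_subset (hJ.1 m).1 hg, ?_⟩
  obtain ⟨f, hf, hf0, a, ha, rfl⟩ := hg
  refine subset_spanIn _ _ ⟨incAct K c p f, hJ.2 m n hmn ⟨p, hp, f, hf, rfl⟩, ?_,
    _, ha.incAct hT hp.1, ?_⟩
  · rw [incAct]
    exact (map_ne_zero_iff _ (rename_injective _ (incVar_injective c hp.1.injective))).2 hf0
  · rw [incAct, rename_monomial]

/-- A leading monomial of an element of `J_n` supported on `N` columns is an `Inc(ℕ)`-shift of
a leading monomial of an element of `J_M`, once `J_n ∩ R_N ⊆ J_M`. -/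
lemma IsSymChain.leadMonSet_subset_incOrbit {K : Type*} [Field K] {c : ℕ}
    {J : ℕ → Set (PolyR K c)} (hJ : IsSymChain K c J) {T : TermOrder (Fin c × ℕ)}
    (hT : IncCompatible c T) {N M n : ℕ} (hNM : N ≤ M) (hMn : M ≤ n)
    (hM : ∀ f ∈ J n, f ∈ Rset K c N → f ∈ J M) {i : Fin N → ℕ} (hinj : Function.Injective i)
    (hi : ∀ r, i r < n) :
    leadMonSet K c T (J n ∩ RsetOn K c (Set.range i)) ⊆
      incOrbit K c M n (leadMonSet K c T (J M)) := by
  rintro _ ⟨f, ⟨hfn, hfi⟩, hf0, a, ha, rfl⟩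
  obtain ⟨p, hp, hcover⟩ := exists_incIn_cover hNM hMn i hi
  choose h hlt hph using hcover
  obtain ⟨σ, hσ, hσp⟩ := exists_perm_extend hMn hp.2 hp.1.injective.injOn
  have hσ' : ∀ i, n ≤ i → σ.symm i = i := fun i hi => by
    rw [Equiv.symm_apply_eq, hσ i hi]
  have hgh : incAct K c σ.symm f ∈ RsetOn K c (Set.range h) := by
    refine incAct_mem_RsetOn ?_ hfi
    rintro _ ⟨r, rfl⟩
    rw [← hph r, ← hσp _ (hlt r), Equiv.symm_apply_apply]
    exact ⟨r, rfl⟩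
  have hg : incAct K c σ.symm f ∈ J M :=
    hJ.mem_of_contraction_stable hNM hMn hM
      (fun r s hrs => hinj (by rw [← hph r, ← hph s, hrs])) hlt (hJ.perm_mem hσ' hfn) hgh
  have hpf : incAct K c p (incAct K c σ.symm f) = f := by
    rw [incAct_congr (q := σ) (fun j hj => (hσp j hj).symm) ((hJ.1 M).1 hg), incAct_incAct]
    exact incAct_eq_self (fun j _ => σ.apply_symm_apply j) hfi
  have hg0 : incAct K c σ.symm f ≠ 0 := by
    intro h0
    rw [h0, map_zero] at hpf
    exact hf0 hpf.symm
  obtain ⟨b, hb⟩ := T.exists_isLeadMon hg0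
  have hab : a = Finsupp.mapDomain (incVar c p) b :=
    TermOrder.isLeadMon_unique ha (hpf ▸ hb.incAct hT hp.1)
  refine ⟨p, hp, monomial b 1, ⟨_, hg, hg0, b, hb, rfl⟩, ?_⟩
  rw [hab, incAct, rename_monomial]

/-- **Theorem (Statement 12).** Let `J∘` be an `S∞`-invariant ideal chain in `R` such that
there exists `N ∈ ℕ` with
`in_⪯(J_n) = Σ_{1 ≤ i₁ < ... < i_N ≤ n} ⟨in_⪯(J_n ∩ R_{{i₁,...,i_N}})⟩_{R_n}`
for all `n ≥ N` and every `Inc(ℕ)`-compatible term order `⪯` on `R`.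
Then `I(J∘)` is bounded above. -/
theorem indSet_bddAbove_of_sum_decomposition (K : Type*) [Field K] (c : ℕ) (hc : 0 < c)
    (J : ℕ → Set (PolyR K c)) (hJ : IsSymChain K c J)
    (hdec : ∃ N : ℕ, ∀ n, N ≤ n → ∀ T : TermOrder (Fin c × ℕ), IncCompatible c T →
      inChain K c T J n =
        spanIn (Rset K c n)
          (⋃ i ∈ {i : Fin N → ℕ | StrictMono i ∧ ∀ r, i r < n},
            initialOn K c T (Set.range i) (J n ∩ RsetOn K c (Set.range i)))) :
    BddAbove (IndSet K c J) := by
  obtain ⟨N, hN⟩ := hdec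
  obtain ⟨M, hNM, hM⟩ := hJ.exists_contraction_stable N
  refine ⟨M, ?_⟩
  rintro _ ⟨T, hT, rfl⟩
  refine Nat.sInf_le fun n hMn => ?_
  have hin := hJ.isIncChain.inChain hT
  have horbit := hin.2 M n hMn
  refine subset_antisymm (spanIn_subset (hin.1 n) horbit) ?_
  have hspan := isIdealOf_spanIn (horbit.trans (hin.1 n).1)
  rw [hN n (hNM.trans hMn) T hT]
  refine spanIn_subset hspan (Set.iUnion₂_subset fun i hi f hf => ?_)
  have hrange : Set.range i ⊆ {j | j < n} := Set.range_subset_iff.2 hi.2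
  have hcomap := hspan.comap (A := Set.range i) (p := id) hrange
  have hid : ∀ g ∈ RsetOn K c (Set.range i), incAct K c id g = g :=
    fun g hg => incAct_eq_self (fun _ _ => rfl) hg
  have hsub := leadMonSet_subset (T := T) (J := J n ∩ RsetOn K c (Set.range i))
    Set.inter_subset_right
  have hmem := spanIn_subset hcomap (fun g hg => ⟨hsub hg, ?_⟩) hf
  · rw [← hid f hmem.1]
    exact hmem.2
  · rw [hid g (hsub hg)]
    obtain ⟨p, hp, b, hb, rfl⟩ :=
      hJ.leadMonSet_subset_incOrbit hT hNM hMn (hM n) hi.1.injective hi.2 hg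
    exact subset_spanIn _ _ ⟨p, hp, b, subset_spanIn _ _ hb, rfl⟩
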